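/- Assume ν ≥ 1 and L ≥ c (a constant depending only on the weighted graph G). For x = (y,z) and x̄ = (ȳ,z̄) in the rectangle D: the entrance probability into the vertical segment J_ȳ satisfies P_x[H_{J_ȳ} < ∞] ≤ c·(H ∧ d_G(y,ȳ)^{β/2})/d_G(y,ȳ)^ν when α > β and y ≠ ȳ; P_x[H_{J_ȳ} < ∞] ≤ c·(1 + log(H^{2/β}/d_G(y,ȳ)))/log H when α = β and 0 < d_G(y,ȳ) < H^{2/β}; P_x[H_{J_ȳ} < ∞] ≤ c·H·d_G(y,ȳ)^{−β/2}/log H when α = β and d_G(y,ȳ) ≥ H^{2/β}; and P_x[H_{J_ȳ} < ∞] ≤ c·(1 ∧ (H^{2/β}/d_G(y,ȳ))^ν) when α < β. The entrance probability into the horizontal segment W_z̄ satisfies P_x[H_{W_z̄} < ∞] ≤ c·(1 ∧ |z−z̄|^{(2/β)(1−ν)}) if ν > 1 (with z ≠ z̄ in the nontrivial case), and P_x[H_{W_z̄} < ∞] ≤ c·(1 + log(L/|z−z̄|^{2/β}))/log L if ν = 1 and z ≠ z̄. -/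

import Mathlib

open MeasureTheory Filter Set
open scoped ENNReal NNReal Topology Classical

noncomputable section

/-- The weighted graph `G`: an infinite connected graph of bounded degree, with a weight
`ρG` which is uniformly bounded and uniformly positive on edges, `α`-Ahlfors regular. -/
structure GraphSetup where
  V : Type
  infV : Infinite V
  adjG : V → V → Prop
  adjG_symm : ∀ {y y'}, adjG y y' → adjG y' y
  adjG_irrefl : ∀ y, ¬adjG y y
  /-- `dG` is the graph distance on `G`; this characterization also encodes connectedness. -/
  dG : V → V → ℕ
  dG_spec : ∀ (y y' : V) (n : ℕ), dG y y' ≤ n ↔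
    ∃ p : ℕ → V, p 0 = y ∧ p n = y' ∧ ∀ i < n, p i = p (i + 1) ∨ adjG (p i) (p (i + 1))
  ballG_fin : ∀ (y : V) (R : ℝ), {y' | (dG y y' : ℝ) ≤ R}.Finite
  degBound : ℕ
  deg_fin : ∀ y : V, {y' | adjG y y'}.Finite
  deg_le : ∀ y : V, Nat.card {y' // adjG y y'} ≤ degBound
  ρG : V → V → ℝ
  ρG_symm : ∀ y y', ρG y y' = ρG y' y
  ρG_nonneg : ∀ y y', 0 ≤ ρG y y'
  ρG_pos_iff : ∀ y y', 0 < ρG y y' ↔ adjG y y'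
  ρG_lbd : ℝ
  ρG_ubd : ℝ
  ρG_lbd_pos : 0 < ρG_lbd
  ρG_bounds : ∀ y y', adjG y y' → ρG_lbd ≤ ρG y y' ∧ ρG y y' ≤ ρG_ubd
  α : ℝ
  β : ℝ
  α_gt_one : 1 < α
  β_ge_two : 2 ≤ β
  β_le_α_add_one : β ≤ α + 1
  cA : ℝ
  cA' : ℝ
  cA_pos : 0 < cA
  /-- `α`-Ahlfors regularity of `(G, ρG)`, lower bound. -/
  ahlfors_lb : ∀ (y : V) (R : ℝ), 1 / 2 ≤ R →
    cA * R ^ α ≤ ∑ y' ∈ (ballG_fin y R).toFinset, ∑' y'', ρG y' y''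
  /-- `α`-Ahlfors regularity of `(G, ρG)`, upper bound. -/
  ahlfors_ub : ∀ (y : V) (R : ℝ), 1 / 2 ≤ R →
    (∑ y' ∈ (ballG_fin y R).toFinset, ∑' y'', ρG y' y'') ≤ cA' * R ^ α

namespace GraphSetup

/-- The product graph `E = G × ℤ`. -/
abbrev E (S : GraphSetup) : Type := S.V × ℤ

instance (S : GraphSetup) : MeasurableSpace S.V := ⊤

/-- The exponent `ν = α - β/2`. -/
def ν (S : GraphSetup) : ℝ := S.α - S.β / 2

/-- Adjacency on `E = G × ℤ`. -/
def adjE (S : GraphSetup) (x x' : S.E) : Prop :=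
  (x.2 = x'.2 ∧ S.adjG x.1 x'.1) ∨ (x.1 = x'.1 ∧ (x.2 - x'.2).natAbs = 1)

/-- The weight on `E`: `ρG` on horizontal edges, `1` on vertical edges. -/
def ρE (S : GraphSetup) (x x' : S.E) : ℝ :=
  if x.2 = x'.2 then S.ρG x.1 x'.1
  else if x.1 = x'.1 ∧ (x.2 - x'.2).natAbs = 1 then 1 else 0

/-- `ρ(x) = Σ_{x' ~ x} ρ_{x,x'}`. -/
def ρEpt (S : GraphSetup) (x : S.E) : ℝ := ∑' x', S.ρE x x'

/-- Transition probability of the walk on `E`. -/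
def ptrans (S : GraphSetup) (x x' : S.E) : ℝ := S.ρE x x' / S.ρEpt x

/-- The metric `d((y,z),(y',z')) = max (d_G(y,y'), |z - z'|^{2/β})` on `E`. -/
def dE (S : GraphSetup) (x x' : S.E) : ℝ :=
  max (S.dG x.1 x'.1 : ℝ) (|(x.2 : ℝ) - (x'.2 : ℝ)| ^ (2 / S.β))

/-- Closed `d`-ball in `E`. -/
def ball (S : GraphSetup) (x : S.E) (r : ℝ) : Set S.E := {x' | S.dE x x' ≤ r}

/-- Vertex boundary `∂U`. -/
def vBoundary (S : GraphSetup) (U : Set S.E) : Set S.E :=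
  {x | x ∉ U ∧ ∃ x' ∈ U, S.adjE x x'}

/-- Closure `U ∪ ∂U`. -/
def cl (S : GraphSetup) (U : Set S.E) : Set S.E := U ∪ S.vBoundary U

/-- Interior vertex boundary `∂_int U`. -/
def intBoundary (S : GraphSetup) (U : Set S.E) : Set S.E :=
  {x | x ∈ U ∧ ∃ x', x' ∉ U ∧ S.adjE x x'}

/-- A nearest-neighbour path of length `n` contained in `A`. -/
def IsPathIn (S : GraphSetup) (A : Set S.E) (p : ℕ → S.E) (n : ℕ) : Prop :=
  (∀ i ≤ n, p i ∈ A) ∧ ∀ i < n, S.adjE (p i) (p (i + 1))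

/-- `B₁` is connected to `B₂` by a nearest-neighbour path contained in `A`. -/
def ConnectsIn (S : GraphSetup) (A B₁ B₂ : Set S.E) : Prop :=
  ∃ (n : ℕ) (p : ℕ → S.E), S.IsPathIn A p n ∧ p 0 ∈ B₁ ∧ p n ∈ B₂

/-- The connected component of `x` inside `A`. -/
def component (S : GraphSetup) (A : Set S.E) (x : S.E) : Set S.E :=
  {x' | S.ConnectsIn A {x} {x'}}

/-- `A` is a connected subset of `E`. -/
def IsConnectedSet (S : GraphSetup) (A : Set S.E) : Prop :=
  ∀ x ∈ A, ∀ x' ∈ A, S.ConnectsIn A {x} {x'}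

/-- `C` separates `A` and `B` in `U`: the graph distance between `A` and `B` exceeds `1`
and every nearest-neighbour path from `∂A` to `∂B` remaining in `U` meets `C`. -/
def Separates (S : GraphSetup) (A B C U : Set S.E) : Prop :=
  (∀ a ∈ A, ∀ b ∈ B, a ≠ b ∧ ¬S.adjE a b) ∧
  ∀ (n : ℕ) (p : ℕ → S.E), (∀ i ≤ n, p i ∈ U) → (∀ i < n, S.adjE (p i) (p (i + 1))) →
    p 0 ∈ S.vBoundary A → p n ∈ S.vBoundary B → ∃ i ≤ n, p i ∈ C

/-- The separation event `S_{x,L}`. -/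
def sepEvent (S : GraphSetup) (x : S.E) (L : ℕ) : Set (Set S.E) :=
  {C | ∃ A₁ A₂ : Set S.E,
    A₁ ⊆ S.cl (S.ball x (3 * L)) ∧ A₂ ⊆ S.cl (S.ball x (3 * L)) ∧
    S.IsConnectedSet A₁ ∧ S.IsConnectedSet A₂ ∧
    (∃ a ∈ A₁, ∃ a' ∈ A₁, (L : ℝ) ≤ S.dE a a') ∧
    (∃ a ∈ A₂, ∃ a' ∈ A₂, (L : ℝ) ≤ S.dE a a') ∧
    S.Separates A₁ A₂ C (S.ball x (5 * L))}

/-- A half-plane of `E = G × ℤ`: the product of a semi-infinite geodesic in `G` with `ℤ`. -/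
structure HalfPlane (S : GraphSetup) where
  ray : ℕ → S.V
  geodesic : ∀ n m : ℕ, S.dG (ray n) (ray m) = Nat.dist n m

/-- The set of points of a half-plane. -/
def HalfPlane.carrier {S : GraphSetup} (P : S.HalfPlane) : Set S.E :=
  {x | ∃ n, x.1 = P.ray n}

/-- `B₁` is connected to `B₂` by a `*`-path contained in `A ∩ 𝒫`. -/
def StarConnectsIn (S : GraphSetup) (P : S.HalfPlane) (A B₁ B₂ : Set S.E) : Prop :=
  ∃ (n : ℕ) (p : ℕ → S.E),
    (∀ i ≤ n, p i ∈ A ∧ p i ∈ P.carrier) ∧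
    (∀ i < n, p i ≠ p (i + 1) ∧ S.dG (p i).1 (p (i + 1)).1 ≤ 1 ∧
      ((p i).2 - (p (i + 1)).2).natAbs ≤ 1) ∧
    p 0 ∈ B₁ ∧ p n ∈ B₂

/-- An increasing event on `{0,1}^E` (configurations identified with subsets of `E`). -/
def IncreasingEvent (S : GraphSetup) (A : Set (Set S.E)) : Prop :=
  ∀ C C' : Set S.E, C ⊆ C' → C ∈ A → C' ∈ A

/-- A decreasing event on `{0,1}^E`. -/
def DecreasingEvent (S : GraphSetup) (A : Set (Set S.E)) : Prop :=
  ∀ C C' : Set S.E, C' ⊆ C → C ∈ A → C' ∈ A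

/-- The event `A` only depends on the coordinates in `B`. -/
def DependsOn (S : GraphSetup) (A : Set (Set S.E)) (B : Set S.E) : Prop :=
  ∀ C C' : Set S.E, C ∩ B = C' ∩ B → (C ∈ A ↔ C' ∈ A)

/-- The family `(G_{x,L})` cascades with complexity at most `lam`, with constant `c`. -/
def CascadesLe (S : GraphSetup) (Gf : S.E → ℕ → Set (Set S.E)) (lam c : ℝ) : Prop :=
  (∀ (x : S.E) (L : ℕ), 1 ≤ L → S.DependsOn (Gf x L) (S.ball x (10 * L))) ∧
  ∀ (ℓ : ℕ) (x : S.E) (L : ℕ), 1 ≤ L → 0 < ℓ → 100 ∣ ℓ →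
    ∃ Λ : Finset S.E, ↑Λ ⊆ S.ball x (9 * ℓ * L) ∧ (Λ.card : ℝ) ≤ c * (ℓ : ℝ) ^ lam ∧
      Gf x (ℓ * L) ⊆
        ⋃ x' ∈ Λ, ⋃ x'' ∈ Λ,
          ⋃ (_ : ((ℓ * L : ℕ) : ℝ) / 100 ≤ S.dE x' x''), Gf x' L ∩ Gf x'' L

/-- The length scales `L_n = ℓ₀ⁿ L₀`. -/
def Lscale (ℓ₀ L₀ n : ℕ) : ℕ := ℓ₀ ^ n * L₀

/-- Membership in `Λ_n`: an embedding of the dyadic tree of depth `n` in `E`,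
with nested balls and spread-out children. -/
def IsTreeEmbed (S : GraphSetup) (ℓ₀ L₀ n : ℕ) (T : ∀ k : ℕ, (Fin k → Bool) → S.E) : Prop :=
  ∀ k < n, ∀ (m : Fin k → Bool) (b : Bool),
    S.ball (T (k + 1) (Fin.snoc m b)) (10 * Lscale ℓ₀ L₀ (n - (k + 1))) ⊆
        S.ball (T k m) (10 * Lscale ℓ₀ L₀ (n - k)) ∧
      ((Lscale ℓ₀ L₀ (n - k) : ℝ)) / 100 ≤
        S.dE (T (k + 1) (Fin.snoc m false)) (T (k + 1) (Fin.snoc m true))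

/-- The factor `1 + c₁ √K (k+1)^{-3/2} ℓ₀^{-(ν-ν')/2}`. -/
def decFactor (c₁ K νv ν' : ℝ) (ℓ₀ : ℕ) (k : ℕ) : ℝ :=
  1 + c₁ * Real.sqrt K * ((k : ℝ) + 1) ^ (-(3 : ℝ) / 2) * (ℓ₀ : ℝ) ^ (-(νv - ν') / 2)

/-- The increasing sequence of levels `u_n⁺`. -/
def uPlusSeq (c₁ K νv ν' : ℝ) (ℓ₀ : ℕ) (u₀ : ℝ) (n : ℕ) : ℝ :=
  (∏ k ∈ Finset.range n, decFactor c₁ K νv ν' ℓ₀ k) * u₀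

/-- The decreasing sequence of levels `u_n⁻`. -/
def uMinusSeq (c₁ K νv ν' : ℝ) (ℓ₀ : ℕ) (u₀ : ℝ) (n : ℕ) : ℝ :=
  (∏ k ∈ Finset.range n, (decFactor c₁ K νv ν' ℓ₀ k)⁻¹) * u₀

/-- The limit `u_∞⁺` of `u_n⁺`. -/
def uPlusInf (c₁ K νv ν' : ℝ) (ℓ₀ : ℕ) (u₀ : ℝ) : ℝ := ⨆ n, uPlusSeq c₁ K νv ν' ℓ₀ u₀ n

/-- The limit `u_∞⁻` of `u_n⁻`. -/
def uMinusInf (c₁ K νv ν' : ℝ) (ℓ₀ : ℕ) (u₀ : ℝ) : ℝ := ⨅ n, uMinusSeq c₁ K νv ν' ℓ₀ u₀ n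

/-- The error term `ε(u) = 2 e^{-K u L₀^ν ℓ₀^{ν'}} / (1 - e^{-K u L₀^ν ℓ₀^{ν'}})`. -/
def epsDecouple (K u : ℝ) (L₀ ℓ₀ : ℕ) (νv ν' : ℝ) : ℝ :=
  2 * Real.exp (-(K * u * (L₀ : ℝ) ^ νv * (ℓ₀ : ℝ) ^ ν')) /
    (1 - Real.exp (-(K * u * (L₀ : ℝ) ^ νv * (ℓ₀ : ℝ) ^ ν')))

/-- The canonical law of the random walk on `E`, as a family of measures on trajectories. -/
structure WalkLaw (S : GraphSetup) where
  P : S.E → Measure (ℕ → S.E)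
  isProb : ∀ x, IsProbabilityMeasure (P x)
  cyl : ∀ (x : S.E) (n : ℕ) (q : ℕ → S.E), q 0 = x →
    P x {w | ∀ i ≤ n, w i = q i} =
      ENNReal.ofReal (∏ i ∈ Finset.range n, S.ptrans (q i) (q (i + 1)))
  cyl0 : ∀ (x : S.E) (q : ℕ → S.E), q 0 ≠ x → P x {w | w 0 = q 0} = 0

instance {S : GraphSetup} (W : WalkLaw S) (x : S.E) : IsProbabilityMeasure (W.P x) :=
  W.isProb x

namespace WalkLaw

variable {S : GraphSetup}

/-- `P_x[H_K < ∞]`, the probability to ever enter `K`. -/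
def hitProb (W : WalkLaw S) (x : S.E) (K : Set S.E) : ℝ≥0∞ := W.P x {w | ∃ n, w n ∈ K}

/-- `P_x[H̃_K = ∞]`, the probability never to hit `K` at a positive time. -/
def escProb (W : WalkLaw S) (x : S.E) (K : Set S.E) : ℝ≥0∞ :=
  W.P x {w | ∀ n, 1 ≤ n → w n ∉ K}

/-- `P_x[H_K < ∞, X_{H_K} = x']`, the probability to enter `K` for the first time at `x'`. -/
def entersAt (W : WalkLaw S) (x : S.E) (K : Set S.E) (x' : S.E) : ℝ≥0∞ :=
  W.P x {w | ∃ n, w n = x' ∧ ∀ m < n, w m ∉ K}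

/-- The equilibrium measure `e_K`. -/
def equilibrium (W : WalkLaw S) (K : Set S.E) (x : S.E) : ℝ :=
  if x ∈ K then (W.escProb x K).toReal * S.ρEpt x else 0

/-- The capacity `cap(K) = Σ_{x ∈ K} P_x[H̃_K = ∞] ρ(x)`. -/
def capacity (W : WalkLaw S) (K : Set S.E) : ℝ :=
  ∑' x : K, (W.escProb x.1 K).toReal * S.ρEpt x.1

/-- The Green density `g(x,x') = Σ_{n ≥ 0} P_x[X_n = x'] / ρ(x')`. -/
def green (W : WalkLaw S) (x x' : S.E) : ℝ :=
  (∑' n : ℕ, (W.P x {w | w n = x'}).toReal) / S.ρEpt x'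

/-- The standing assumption `c (d(x,x') ∨ 1)^{-ν} ≤ g(x,x') ≤ c' (d(x,x') ∨ 1)^{-ν}`. -/
def GreenBounds (W : WalkLaw S) (cg cg' : ℝ) : Prop :=
  0 < cg ∧ cg ≤ cg' ∧ ∀ x x' : S.E,
    cg * (max (S.dE x x') 1) ^ (-S.ν) ≤ W.green x x' ∧
      W.green x x' ≤ cg' * (max (S.dE x x') 1) ^ (-S.ν)

end WalkLaw

/-- Random interlacements on `E`, encoded by their canonical probability space and the
family of interlacement sets `ℐ^u`, `u ≥ 0`, with
`ℙ[𝒱^u ⊇ K] = exp(-u cap(K))` for all finite `K`. -/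
structure Interlacement (S : GraphSetup) (W : WalkLaw S) where
  Ω : Type
  mΩ : MeasurableSpace Ω
  prob : @Measure Ω mΩ
  isProb : IsProbabilityMeasure prob
  I : ℝ → Ω → Set S.E
  I_mono : ∀ u u' : ℝ, u ≤ u' → ∀ ω, I u ω ⊆ I u' ω
  vacant_law : ∀ u : ℝ, 0 ≤ u → ∀ K : Set S.E, K.Finite →
    prob {ω | Disjoint K (I u ω)} = ENNReal.ofReal (Real.exp (-(u * W.capacity K)))

namespace Interlacement

variable {S : GraphSetup} {W : WalkLaw S}

/-- The vacant set `𝒱^u = E ∖ ℐ^u`. -/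
def vacant (RI : Interlacement S W) (u : ℝ) (ω : RI.Ω) : Set S.E := (RI.I u ω)ᶜ

/-- The event that `x` lies in an infinite connected component of `𝒱^u`. -/
def percolates (RI : Interlacement S W) (x : S.E) (u : ℝ) : Set RI.Ω :=
  {ω | (S.component (RI.vacant u ω) x).Infinite}

/-- The one-arm event: `B(x,L)` is connected to `∂_int B(x,2L)` in `𝒱^u`. -/
def oneArm (RI : Interlacement S W) (x : S.E) (L : ℝ) (u : ℝ) : Set RI.Ω :=
  {ω | S.ConnectsIn (RI.vacant u ω) (S.ball x L) (S.intBoundary (S.ball x (2 * L)))}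

/-- `sup_{x ∈ E} ℙ[B(x,L) ↔ ∂_int B(x,2L) in 𝒱^u]`. -/
def oneArmSup (RI : Interlacement S W) (u : ℝ) (L : ℕ) : ℝ≥0∞ :=
  ⨆ x : S.E, RI.prob (RI.oneArm x L u)

/-- The set defining `u_*`. -/
def uStarSet (RI : Interlacement S W) : Set ℝ :=
  {u | 0 ≤ u ∧ ∀ x : S.E, RI.prob (RI.percolates x u) = 0}

/-- The critical level `u_*`. -/
def uStar (RI : Interlacement S W) : ℝ := sInf RI.uStarSet

/-- The set defining `u_**`. -/
def uStarStarSet (RI : Interlacement S W) : Set ℝ :=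
  {u | 0 ≤ u ∧ Filter.liminf (fun L : ℕ => RI.oneArmSup u L) Filter.atTop = 0}

/-- The critical level `u_**`. -/
def uStarStar (RI : Interlacement S W) : ℝ := sInf RI.uStarStarSet

/-- The `*`-crossing event for `ℐ^u` inside a half-plane. -/
def starCross (RI : Interlacement S W) (P : S.HalfPlane) (x : S.E) (L : ℝ) (u : ℝ) :
    Set RI.Ω :=
  {ω | S.StarConnectsIn P (RI.I u ω) (S.ball x L) (S.intBoundary (S.ball x (2 * L)))}

/-- `sup_{𝒫, x ∈ 𝒫} ℙ[B(x,L) ↔* ∂_int B(x,2L) in ℐ^u ∩ 𝒫]`. -/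
def starSup (RI : Interlacement S W) (u : ℝ) (L : ℕ) : ℝ≥0∞ :=
  ⨆ P : S.HalfPlane, ⨆ x : P.carrier, RI.prob (RI.starCross P x.1 L u)

/-- The set defining `ũ`. -/
def uTildeSet (RI : Interlacement S W) : Set ℝ :=
  {u | 0 ≤ u ∧ 0 < Filter.liminf (fun L : ℕ => RI.starSup u L) Filter.atTop}

/-- The critical level `ũ`. -/
def uTilde (RI : Interlacement S W) : ℝ := sInf RI.uTildeSet

/-- For an event `A` on `{0,1}^E`, the event `A^u` that the indicator of `ℐ^u` lies in `A`. -/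
def eventAt (RI : Interlacement S W) (A : Set (Set S.E)) (u : ℝ) : Set RI.Ω :=
  {ω | RI.I u ω ∈ A}

end Interlacement

end GraphSetup

open GraphSetup

namespace GraphSetup

variable {S : GraphSetup}

lemma countable_V (S : GraphSetup) : Countable S.V := by
  rw [← Set.countable_univ_iff]
  obtain ⟨y⟩ : Nonempty S.V := S.infV.nonempty
  have h : (Set.univ : Set S.V) = ⋃ n : ℕ, {y' | (S.dG y y' : ℝ) ≤ n} := by
    ext y'
    simp only [mem_univ, mem_iUnion, mem_ofPred_eq, true_iff]
    exact ⟨S.dG y y', le_rfl⟩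
  rw [h]
  exact Set.countable_iUnion fun n => (S.ballG_fin y n).countable

instance : Countable S.V := S.countable_V

instance : DiscreteMeasurableSpace S.V := ⟨fun _ => trivial⟩

lemma dG_self (y : S.V) : S.dG y y = 0 :=
  Nat.le_zero.1 ((S.dG_spec y y 0).2 ⟨fun _ => y, rfl, rfl, by simp⟩)

lemma dG_pos {y y' : S.V} (h : y ≠ y') : 0 < S.dG y y' := by
  rw [pos_iff_ne_zero]
  intro h0
  obtain ⟨p, hp, hp', -⟩ := (S.dG_spec y y' 0).1 h0.le
  exact h (hp.symm.trans hp')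

lemma ρE_nonneg (x x' : S.E) : 0 ≤ S.ρE x x' := by
  unfold ρE
  split_ifs
  · exact S.ρG_nonneg _ _
  · exact zero_le_one
  · exact le_rfl

lemma ρEpt_nonneg (x : S.E) : 0 ≤ S.ρEpt x := tsum_nonneg fun _ => ρE_nonneg _ _

lemma ptrans_nonneg (x x' : S.E) : 0 ≤ S.ptrans x x' :=
  div_nonneg (ρE_nonneg _ _) (ρEpt_nonneg _)

namespace WalkLaw

variable (W : WalkLaw S)

lemma ae_start (x : S.E) : ∀ᵐ w ∂(W.P x), w 0 = x := by
  have h := W.cyl x 0 (fun _ => x) rfl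
  simp only [nonpos_iff_eq_zero, forall_eq, Finset.range_zero, Finset.prod_empty,
    ENNReal.ofReal_one] at h
  have hm : MeasurableSet {w : ℕ → S.E | w 0 = x} :=
    measurableSet_eq_fun (measurable_pi_apply 0) measurable_const
  exact (prob_compl_eq_zero_iff hm).2 h

/-- The Markov property at time one, for the law of finitely many steps of the walk. -/
lemma map_shift (x : S.E) (n : ℕ) :
    (W.P x).map (fun w (i : Fin (n + 1)) => w (i + 1)) =
      Measure.sum fun y => ENNReal.ofReal (S.ptrans x y) •
        (W.P y).map (fun w (i : Fin (n + 1)) => w i) := by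
  have hm1 : Measurable fun (w : ℕ → S.E) (i : Fin (n + 1)) => w (i + 1) := by fun_prop
  have hm2 : Measurable fun (w : ℕ → S.E) (i : Fin (n + 1)) => w i := by fun_prop
  refine Measure.ext_of_singleton fun v => ?_
  rw [Measure.map_apply hm1 (measurableSet_singleton v),
    Measure.sum_apply _ (measurableSet_singleton v)]
  simp only [Measure.smul_apply, Measure.map_apply hm2 (measurableSet_singleton v), smul_eq_mul]
  let q : ℕ → S.E := fun i => if h : i < n + 1 then v ⟨i, h⟩ else x
  have hq : ∀ i : Fin (n + 1), q i = v i := fun i => dif_pos i.2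
  let q' : ℕ → S.E := fun i => Nat.casesOn i x q
  have h2 : (fun (w : ℕ → S.E) (i : Fin (n + 1)) => w i) ⁻¹' {v} =
      {w | ∀ i ≤ n, w i = q i} := by
    ext w
    simp only [mem_preimage, mem_singleton_iff, mem_ofPred_eq, funext_iff]
    refine ⟨fun h i hi => ?_, fun h i => (h i (Nat.lt_succ_iff.1 i.2)).trans (hq i)⟩
    exact (h ⟨i, Nat.lt_succ_of_le hi⟩).trans (hq ⟨i, Nat.lt_succ_of_le hi⟩).symm
  have h1 : W.P x ((fun (w : ℕ → S.E) (i : Fin (n + 1)) => w (i + 1)) ⁻¹' {v}) =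
      W.P x {w | ∀ i ≤ n + 1, w i = q' i} := by
    refine measure_congr ?_
    filter_upwards [W.ae_start x] with w hw
    refine propext ?_
    change ((fun i : Fin (n + 1) => w (i + 1)) = v) ↔ ∀ i ≤ n + 1, w i = q' i
    rw [funext_iff]
    constructor
    · rintro h (_ | i) hi
      · exact hw
      · have hi' : i < n + 1 := hi
        exact (h ⟨i, hi'⟩).trans (hq ⟨i, hi'⟩).symm
    · intro h i
      exact (h (i + 1) (Nat.succ_le_of_lt i.2)).trans (hq i)
  rw [h1, h2, W.cyl x (n + 1) q' rfl, Finset.prod_range_succ', mul_comm,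
    ENNReal.ofReal_mul (ptrans_nonneg _ _), tsum_eq_single (q 0)]
  · rw [W.cyl (q 0) n q rfl]
    rfl
  · intro y hy
    have h0 : W.P y {w | ∀ i ≤ n, w i = q i} = 0 :=
      measure_mono_null (fun w hw => hw 0 (Nat.zero_le _)) (W.cyl0 y q hy.symm)
    rw [h0, mul_zero]

lemma measure_shift (x : S.E) (n : ℕ) (B : Set (Fin (n + 1) → S.E)) :
    W.P x {w | (fun i : Fin (n + 1) => w (i + 1)) ∈ B} =
      ∑' y, ENNReal.ofReal (S.ptrans x y) * W.P y {w | (fun i : Fin (n + 1) => w i) ∈ B} := by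
  have hm1 : Measurable fun (w : ℕ → S.E) (i : Fin (n + 1)) => w (i + 1) := by fun_prop
  have hm2 : Measurable fun (w : ℕ → S.E) (i : Fin (n + 1)) => w i := by fun_prop
  have hB : MeasurableSet B := MeasurableSet.of_discrete
  have h := congrArg (fun μ => μ B) (W.map_shift x n)
  simp only [Measure.map_apply hm1 hB, Measure.sum_apply _ hB, Measure.smul_apply,
    Measure.map_apply hm2 hB, smul_eq_mul] at h
  exact h

/-- The Green function with respect to the counting measure, as an extended real. -/
def greenCount (x x' : S.E) : ℝ≥0∞ := ∑' n : ℕ, W.P x {w | w n = x'}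

lemma tsum_ptrans_mul_greenCount_le (x k : S.E) :
    ∑' y, ENNReal.ofReal (S.ptrans x y) * W.greenCount y k ≤ W.greenCount x k := by
  unfold greenCount
  simp_rw [← ENNReal.tsum_mul_left]
  rw [ENNReal.tsum_comm, tsum_eq_zero_add' (f := fun n : ℕ => W.P x {w | w n = k})
    ENNReal.summable]
  refine le_add_left (ENNReal.tsum_le_tsum fun n => le_of_eq ?_)
  exact (W.measure_shift x n {v | v (Fin.last n) = k}).symm

lemma green_eq (x x' : S.E) : W.green x x' = (W.greenCount x x').toReal / S.ρEpt x' := by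
  rw [green, greenCount, ENNReal.tsum_toReal_eq fun n => measure_ne_top _ _]

lemma ofReal_green {x x' : S.E} (h : 0 < W.green x x') :
    ENNReal.ofReal (W.green x x') = W.greenCount x x' * (ENNReal.ofReal (S.ρEpt x'))⁻¹ := by
  rw [green_eq] at h ⊢
  have hρ : 0 < S.ρEpt x' := by
    refine (ρEpt_nonneg x').lt_of_ne fun h0 => ?_
    simp [← h0] at h
  have hg : W.greenCount x x' ≠ ∞ := by
    rintro h0
    simp [h0] at h
  rw [ENNReal.ofReal_div_of_pos hρ, ENNReal.ofReal_toReal hg, div_eq_mul_inv]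

lemma tsum_ptrans_mul_green_le (hpos : ∀ x x', 0 < W.green x x') (x k : S.E) :
    ∑' y, ENNReal.ofReal (S.ptrans x y) * ENNReal.ofReal (W.green y k) ≤
      ENNReal.ofReal (W.green x k) := by
  simp_rw [W.ofReal_green (hpos _ _), ← mul_assoc]
  rw [ENNReal.tsum_mul_right]
  exact mul_le_mul_left (W.tsum_ptrans_mul_greenCount_le x k) _

/-- A superharmonic function which is at least `m` on `K` dominates `m` times the probability
to enter `K`. -/
lemma mul_hitProb_le_of_superharmonic (K : Set S.E) (m : ℝ≥0∞) (u : S.E → ℝ≥0∞)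
    (hu : ∀ x, ∑' y, ENNReal.ofReal (S.ptrans x y) * u y ≤ u x) (hm : ∀ x ∈ K, m ≤ u x)
    (x : S.E) : m * W.hitProb x K ≤ u x := by
  have key : ∀ (n : ℕ) (x : S.E), m * W.P x {w | ∃ i ≤ n, w i ∈ K} ≤ u x := by
    intro n
    induction n with
    | zero =>
      intro x
      by_cases hx : x ∈ K
      · exact (mul_le_of_le_one_right' prob_le_one).trans (hm x hx)
      · have h0 : W.P x {w | ∃ i ≤ 0, w i ∈ K} = 0 := by
          refine measure_mono_null ?_ (W.ae_start x)
          rintro w ⟨i, hi, hw⟩ h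
          obtain rfl := Nat.le_zero.1 hi
          exact hx (h ▸ hw)
        rw [h0, mul_zero]
        exact zero_le
    | succ n ih =>
      intro x
      by_cases hx : x ∈ K
      · exact (mul_le_of_le_one_right' prob_le_one).trans (hm x hx)
      · have h0 : W.P x {w | ∃ i ≤ n + 1, w i ∈ K} ≤
            W.P x {w | ∃ i : Fin (n + 1), w (i + 1) ∈ K} := by
          refine measure_mono_ae ?_
          filter_upwards [W.ae_start x] with w hw
          rintro ⟨i, hi, hwi⟩
          rcases i with _ | i
          · exact absurd (hw ▸ hwi) hx
          · exact ⟨⟨i, hi⟩, hwi⟩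
        have h1 := W.measure_shift x n {v | ∃ i, v i ∈ K}
        calc m * W.P x {w | ∃ i ≤ n + 1, w i ∈ K}
            ≤ m * ∑' y, ENNReal.ofReal (S.ptrans x y) *
                W.P y {w | ∃ i : Fin (n + 1), w i ∈ K} := by
              gcongr
              exact h0.trans h1.le
          _ = ∑' y, ENNReal.ofReal (S.ptrans x y) *
                (m * W.P y {w | ∃ i : Fin (n + 1), w i ∈ K}) := by
              rw [← ENNReal.tsum_mul_left]
              exact tsum_congr fun y => by ring
          _ ≤ ∑' y, ENNReal.ofReal (S.ptrans x y) * u y := by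
              refine ENNReal.tsum_le_tsum fun y => ?_
              gcongr
              refine le_trans ?_ (ih y)
              gcongr
              rintro ⟨i, hi⟩
              exact ⟨i, Nat.lt_succ_iff.1 i.2, hi⟩
          _ ≤ u x := hu x
  have hU : {w : ℕ → S.E | ∃ n, w n ∈ K} = ⋃ n, {w | ∃ i ≤ n, w i ∈ K} := by
    ext w
    simp only [mem_ofPred_eq, mem_iUnion]
    exact ⟨fun ⟨n, h⟩ => ⟨n, n, le_rfl, h⟩, fun ⟨_, i, _, h⟩ => ⟨i, h⟩⟩
  have hmono : Monotone fun n => {w : ℕ → S.E | ∃ i ≤ n, w i ∈ K} :=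
    fun a b hab w ⟨i, hi, h⟩ => ⟨i, hi.trans hab, h⟩
  rw [hitProb, hU, hmono.measure_iUnion, ENNReal.mul_iSup]
  exact iSup_le fun n => key n x

lemma mul_hitProb_le_sum_green (hpos : ∀ x x', 0 < W.green x x') (K : Set S.E)
    {ι : Type*} (s : Finset ι) (κ : ι → S.E) (m : ℝ) (hm0 : 0 ≤ m)
    (hm : ∀ x ∈ K, m ≤ ∑ j ∈ s, W.green x (κ j)) (x : S.E) :
    m * (W.hitProb x K).toReal ≤ ∑ j ∈ s, W.green x (κ j) := by
  have hsum : ∀ x, ENNReal.ofReal (∑ j ∈ s, W.green x (κ j)) =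
      ∑ j ∈ s, ENNReal.ofReal (W.green x (κ j)) := fun x =>
    ENNReal.ofReal_sum_of_nonneg fun j _ => (hpos _ _).le
  have h := W.mul_hitProb_le_of_superharmonic K (ENNReal.ofReal m)
    (fun x => ENNReal.ofReal (∑ j ∈ s, W.green x (κ j))) (fun x => ?_)
    (fun x hx => ENNReal.ofReal_le_ofReal (hm x hx)) x
  · have h' := ENNReal.toReal_mono ENNReal.ofReal_ne_top h
    rwa [ENNReal.toReal_mul, ENNReal.toReal_ofReal hm0,
      ENNReal.toReal_ofReal (Finset.sum_nonneg fun j _ => (hpos _ _).le)] at h'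
  · simp_rw [hsum, Finset.mul_sum]
    rw [Summable.tsum_finsetSum fun j _ => ENNReal.summable]
    exact Finset.sum_le_sum fun j _ => W.tsum_ptrans_mul_green_le hpos x (κ j)

/-- Entrance probabilities are bounded by quotients of sums of powers of distances. -/
lemma hitProb_le_of_greenBounds {cg cg' : ℝ} (hG : W.GreenBounds cg cg') (K : Set S.E)
    (x : S.E) {ι : Type*} (s : Finset ι) (κ : ι → S.E) {A B : ℝ} (hB : 0 < B)
    (hA : ∑ j ∈ s, (max (S.dE x (κ j)) 1) ^ (-S.ν) ≤ A)
    (hK : ∀ x' ∈ K, B ≤ ∑ j ∈ s, (max (S.dE x' (κ j)) 1) ^ (-S.ν)) :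
    (W.hitProb x K).toReal ≤ cg' / cg * (A / B) := by
  obtain ⟨h0, h01, hg⟩ := hG
  have hpos : ∀ x x', 0 < W.green x x' := fun x x' => by
    refine lt_of_lt_of_le ?_ (hg x x').1
    have : (0 : ℝ) < max (S.dE x x') 1 := lt_of_lt_of_le one_pos (le_max_right _ _)
    positivity
  have h := W.mul_hitProb_le_sum_green hpos K s κ (cg * B) (by positivity) (fun x' hx' => ?_) x
  · have h2 : ∑ j ∈ s, W.green x (κ j) ≤ cg' * A := by
      refine le_trans ?_ (mul_le_mul_of_nonneg_left hA (h0.le.trans h01))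
      rw [Finset.mul_sum]
      exact Finset.sum_le_sum fun j _ => (hg _ _).2
    rw [div_mul_div_comm, le_div_iff₀ (by positivity), mul_comm]
    exact h.trans h2
  · refine (mul_le_mul_of_nonneg_left (hK x' hx') h0.le).trans ?_
    rw [Finset.mul_sum]
    exact Finset.sum_le_sum fun j _ => (hg _ _).1

lemma hitProb_toReal_le_one (x : S.E) (K : Set S.E) : (W.hitProb x K).toReal ≤ 1 :=
  by
  have h : W.hitProb x K ≤ 1 := prob_le_one
  exact ENNReal.toReal_le_of_le_ofReal zero_le_one (by simpa using h)

end WalkLaw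

end GraphSetup

lemma sum_range_dist {M : Type*} [AddCommMonoid M] (f : ℕ → M) {N i : ℕ} (hi : i < N) :
    ∑ j ∈ Finset.range N, f (Nat.dist i j) =
      ∑ j ∈ Finset.range i, f (j + 1) + ∑ j ∈ Finset.range (N - i), f j := by
  rw [← Finset.sum_range_add_sum_Ico _ hi.le, Finset.sum_Ico_eq_sum_range,
    ← Finset.sum_range_reflect (fun j => f (j + 1))]
  congr 1
  · refine Finset.sum_congr rfl fun j hj => ?_
    have := Finset.mem_range.1 hj
    congr 1
    rw [Nat.dist]
    omega
  · refine Finset.sum_congr rfl fun j _ => ?_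
    congr 1
    rw [Nat.dist]
    omega

lemma sum_range_dist_le {f : ℕ → ℝ} (hf : ∀ j, 0 ≤ f j) {N i : ℕ} (hi : i < N) :
    ∑ j ∈ Finset.range N, f (Nat.dist i j) ≤ 2 * ∑ j ∈ Finset.range N, f j := by
  rw [sum_range_dist f hi, two_mul]
  refine add_le_add ?_ ?_
  · have h1 : ∑ j ∈ Finset.range i, f (j + 1) ≤ ∑ j ∈ Finset.range (i + 1), f j := by
      rw [Finset.sum_range_succ']
      exact le_add_of_nonneg_right (hf 0)
    exact h1.trans (Finset.sum_le_sum_of_subset_of_nonneg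
      (Finset.range_mono hi) fun j _ _ => hf j)
  · exact Finset.sum_le_sum_of_subset_of_nonneg
      (Finset.range_mono (Nat.sub_le _ _)) fun j _ _ => hf j

lemma inv_add_one_le_log_div {x : ℝ} (hx : 0 < x) : (x + 1)⁻¹ ≤ Real.log ((x + 1) / x) := by
  have h := Real.log_le_sub_one_of_pos (show 0 < x / (x + 1) by positivity)
  rw [← inv_div, Real.log_inv]
  have : x / (x + 1) - 1 = -(x + 1)⁻¹ := by field_simp; ring
  linarith

lemma sum_inv_add_le {t : ℝ} (ht : 0 < t) (N : ℕ) :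
    ∑ j ∈ Finset.range (N + 1), (t + j)⁻¹ ≤ t⁻¹ + Real.log ((t + N) / t) := by
  induction N with
  | zero => simp [ht.ne']
  | succ n ih =>
    rw [Finset.sum_range_succ]
    have h0 : 0 < t + n := by positivity
    have h := inv_add_one_le_log_div h0
    have h2 : Real.log ((t + (n + 1 : ℕ)) / t) =
        Real.log ((t + n) / t) + Real.log ((t + n + 1) / (t + n)) := by
      rw [← Real.log_mul (by positivity) (by positivity)]
      congr 1
      push_cast
      field_simp
      ring
    rw [h2]
    push_cast
    rw [← add_assoc t]
    linarith

lemma mul_rpow_add_one_le {p x : ℝ} (hp : 1 < p) (hx : 0 < x) :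
    (p - 1) * (x + 1) ^ (-p) ≤ x ^ (1 - p) - (x + 1) ^ (1 - p) := by
  have h1 : (x + 1) ^ (1 - p) = (x + 1) * (x + 1) ^ (-p) := by
    rw [sub_eq_add_neg, Real.rpow_add (by positivity), Real.rpow_one]
  have h2 : x ^ (1 - p) = (x + 1) ^ (1 - p) * ((x + 1) / x) ^ (p - 1) := by
    rw [Real.div_rpow (by positivity) hx.le, ← mul_div_assoc,
      ← Real.rpow_add (by positivity)]
    rw [show 1 - p = -(p - 1) by ring, Real.rpow_neg hx.le]
    simp
  have h3 : 1 + (p - 1) * (x + 1)⁻¹ ≤ ((x + 1) / x) ^ (p - 1) := by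
    rw [Real.rpow_def_of_pos (by positivity)]
    have h := mul_le_mul_of_nonneg_left (inv_add_one_le_log_div hx) (sub_nonneg.2 hp.le)
    have h' := Real.add_one_le_exp (Real.log ((x + 1) / x) * (p - 1))
    linarith
  have h4 := mul_le_mul_of_nonneg_left h3 (show 0 ≤ (x + 1) ^ (1 - p) by positivity)
  rw [← h2] at h4
  have h5 : (x + 1) ^ (1 - p) * (1 + (p - 1) * (x + 1)⁻¹) =
      (x + 1) ^ (1 - p) + (p - 1) * (x + 1) ^ (-p) := by
    rw [h1]
    field_simp
  linarith

lemma sum_rpow_add_le {p t : ℝ} (hp : 1 < p) (ht : 0 < t) (N : ℕ) :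
    ∑ j ∈ Finset.range (N + 1), (t + j) ^ (-p) ≤
      t ^ (-p) + (t ^ (1 - p) - (t + N) ^ (1 - p)) / (p - 1) := by
  induction N with
  | zero => simp
  | succ n ih =>
    rw [Finset.sum_range_succ]
    have h := mul_rpow_add_one_le hp (show 0 < t + n by positivity)
    have hp' : 0 < p - 1 := sub_pos.2 hp
    rw [mul_comm, ← le_div_iff₀ hp'] at h
    push_cast
    rw [← add_assoc t]
    have h2 : (t ^ (1 - p) - (t + n + 1) ^ (1 - p)) / (p - 1) =
      (t ^ (1 - p) - (t + n) ^ (1 - p)) / (p - 1) +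
        ((t + n) ^ (1 - p) - (t + n + 1) ^ (1 - p)) / (p - 1) := by ring
    linarith

lemma rpow_max_le {p t u : ℝ} (hp : 0 ≤ p) (ht : 0 < t) (hu : 0 ≤ u) :
    (max t u) ^ (-p) ≤ 2 ^ p * (t + u) ^ (-p) := by
  have h1 : (t + u) / 2 ≤ max t u := by
    linarith [le_max_left t u, le_max_right t u]
  have h2 := Real.rpow_le_rpow_of_nonpos (by positivity) h1 (neg_nonpos.2 hp)
  rw [Real.div_rpow (by linarith) (by norm_num), Real.rpow_neg (by norm_num : (0 : ℝ) ≤ 2) p,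
    div_inv_eq_mul, mul_comm] at h2
  exact h2

lemma sum_rpow_max_dist_le {p t : ℝ} (hp : 1 < p) (ht : 1 ≤ t) {N i : ℕ} (hi : i < N) :
    ∑ j ∈ Finset.range N, (max t (Nat.dist i j : ℝ)) ^ (-p) ≤
      2 * 2 ^ p * (1 + (p - 1)⁻¹) * t ^ (1 - p) := by
  have ht0 : 0 < t := by positivity
  have hp' : 0 < p - 1 := sub_pos.2 hp
  refine (sum_range_dist_le (f := fun k => (max t (k : ℝ)) ^ (-p))
    (fun j => by positivity) hi).trans ?_
  have h1 : ∑ j ∈ Finset.range N, (max t (j : ℝ)) ^ (-p) ≤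
      2 ^ p * ∑ j ∈ Finset.range (N + 1), (t + j) ^ (-p) := by
    rw [Finset.mul_sum]
    refine (Finset.sum_le_sum fun j _ => rpow_max_le (by linarith) ht0 j.cast_nonneg).trans ?_
    exact Finset.sum_le_sum_of_subset_of_nonneg (Finset.range_mono (Nat.le_succ _))
      fun j _ _ => by positivity
  have h2 : ∑ j ∈ Finset.range (N + 1), (t + j) ^ (-p) ≤ (1 + (p - 1)⁻¹) * t ^ (1 - p) := by
    refine (sum_rpow_add_le hp ht0 N).trans ?_
    rw [add_mul, one_mul, mul_comm (p - 1)⁻¹, ← div_eq_mul_inv]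
    have h3 : t ^ (-p) ≤ t ^ (1 - p) := Real.rpow_le_rpow_of_exponent_le ht (by linarith)
    have h4 : 0 ≤ (t + N) ^ (1 - p) := by positivity
    gcongr
    linarith
  have h5 : (0 : ℝ) ≤ 2 ^ p := by positivity
  nlinarith [mul_le_mul_of_nonneg_left h2 h5]

lemma sum_rpow_max_dist_neg_one_le {t : ℝ} (ht : 1 ≤ t) {N i : ℕ} (hi : i < N) :
    ∑ j ∈ Finset.range N, (max t (Nat.dist i j : ℝ)) ^ (-1 : ℝ) ≤
      4 * (1 + Real.log ((t + N) / t)) := by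
  have ht0 : 0 < t := by positivity
  refine (sum_range_dist_le (f := fun k => (max t (k : ℝ)) ^ (-1 : ℝ))
    (fun j => by positivity) hi).trans ?_
  have h1 : ∑ j ∈ Finset.range N, (max t (j : ℝ)) ^ (-1 : ℝ) ≤
      2 * ∑ j ∈ Finset.range (N + 1), (t + j)⁻¹ := by
    rw [Finset.mul_sum]
    refine (Finset.sum_le_sum fun j _ => rpow_max_le zero_le_one ht0 j.cast_nonneg).trans ?_
    simp only [Real.rpow_one, Real.rpow_neg_one]
    exact Finset.sum_le_sum_of_subset_of_nonneg (Finset.range_mono (Nat.le_succ _))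
      fun j _ _ => by positivity
  have h2 := sum_inv_add_le ht0 N
  have h3 : t⁻¹ ≤ 1 := inv_le_one_of_one_le₀ ht
  linarith

lemma log_succ_le_sum_inv (n : ℕ) :
    Real.log (n + 1) ≤ ∑ j ∈ Finset.range n, ((j : ℝ) + 1)⁻¹ := by
  have h := log_add_one_le_harmonic n
  simpa [harmonic] using h

lemma log_le_sum_rpow_max_dist {N i : ℕ} (hi : i < N) :
    Real.log N ≤ ∑ j ∈ Finset.range N, (max (Nat.dist i j : ℝ) 1) ^ (-1 : ℝ) := by
  have hcast : ∀ j : ℕ, max ((j + 1 : ℕ) : ℝ) 1 = j + 1 := fun j => by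
    push_cast
    exact max_eq_left (by linarith [j.cast_nonneg (α := ℝ)])
  obtain ⟨m, rfl⟩ : ∃ m, N = i + m + 1 := ⟨N - i - 1, by omega⟩
  rw [sum_range_dist (fun k => (max (k : ℝ) 1) ^ (-1 : ℝ)) hi,
    show i + m + 1 - i = m + 1 by omega, Finset.sum_range_succ']
  simp only [hcast, Real.rpow_neg_one]
  have h1 := log_succ_le_sum_inv i
  have h2 := log_succ_le_sum_inv m
  have h3 : Real.log ((i + m + 1 : ℕ) : ℝ) ≤ Real.log (i + 1) + Real.log (m + 1) := by
    rw [← Real.log_mul (by positivity) (by positivity)]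
    refine Real.log_le_log (by positivity) ?_
    push_cast
    nlinarith [mul_nonneg (i.cast_nonneg (α := ℝ)) (m.cast_nonneg (α := ℝ))]
  have h4 : (0 : ℝ) ≤ (max ((0 : ℕ) : ℝ) 1)⁻¹ := by positivity
  linarith

lemma one_le_sum_rpow_max_dist {N i : ℕ} (hi : i < N) (p : ℝ) :
    1 ≤ ∑ j ∈ Finset.range N, (max (Nat.dist i j : ℝ) 1) ^ (-p) := by
  have h := Finset.single_le_sum (f := fun j => (max (Nat.dist i j : ℝ) 1) ^ (-p))
    (fun j _ => by positivity) (Finset.mem_range.2 hi)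
  simpa [Nat.dist_self] using h

lemma abs_sub_cast_eq_dist (i j : ℕ) : |(i : ℝ) - (j : ℝ)| = (Nat.dist i j : ℝ) := by
  rcases le_total i j with h | h
  · rw [Nat.dist_eq_sub_of_le h, Nat.cast_sub h, abs_sub_comm,
      abs_of_nonneg (sub_nonneg.2 (Nat.cast_le.2 h))]
  · rw [Nat.dist_eq_sub_of_le_right h, Nat.cast_sub h,
      abs_of_nonneg (sub_nonneg.2 (Nat.cast_le.2 h))]

namespace GraphSetup

variable {S : GraphSetup}

lemma β_pos (S : GraphSetup) : 0 < S.β := by linarith [S.β_ge_two]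

lemma dE_column (y y' : S.V) (z : ℤ) (i j : ℕ) :
    S.dE (y, z + i) (y', z + j) = max (S.dG y y' : ℝ) ((Nat.dist i j : ℝ) ^ (2 / S.β)) := by
  have h : ((z + i : ℤ) : ℝ) - ((z + j : ℤ) : ℝ) = (i : ℝ) - (j : ℝ) := by
    push_cast
    ring
  rw [dE, h, abs_sub_cast_eq_dist]

lemma max_dE_column_self_rpow (y : S.V) (z : ℤ) (i j : ℕ) :
    (max (S.dE (y, z + i) (y, z + j)) 1) ^ (-S.ν) =
      (max (Nat.dist i j : ℝ) 1) ^ (-(2 / S.β * S.ν)) := by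
  have hβ := S.β_pos
  rw [dE_column, dG_self, Nat.cast_zero, max_eq_right (by positivity : (0 : ℝ) ≤ _),
    ← mul_neg, Real.rpow_mul (by positivity),
    Real.rpow_max (p := 2 / S.β) (Nat.cast_nonneg _) zero_le_one (by positivity), Real.one_rpow]

lemma max_dE_column_rpow_le (hν : 0 ≤ S.ν) {y y' : S.V} (hy : 0 < S.dG y y') (z : ℤ)
    (i j : ℕ) :
    (max (S.dE (y, z + i) (y', z + j)) 1) ^ (-S.ν) ≤
      (max ((S.dG y y' : ℝ) ^ (S.β / 2)) (Nat.dist i j : ℝ)) ^ (-(2 / S.β * S.ν)) := by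
  have hβ := S.β_pos
  have hy' : (0 : ℝ) < S.dG y y' := Nat.cast_pos.2 hy
  rw [dE_column, ← mul_neg (2 / S.β), Real.rpow_mul (by positivity),
    Real.rpow_max (p := 2 / S.β) (by positivity) (Nat.cast_nonneg _) (by positivity), ← Real.rpow_mul hy'.le,
    show S.β / 2 * (2 / S.β) = 1 by field_simp, Real.rpow_one]
  exact Real.rpow_le_rpow_of_nonpos (lt_max_of_lt_left hy') (le_max_left _ _)
    (neg_nonpos.2 hν)

lemma max_dE_rpow_le_dG (hν : 0 ≤ S.ν) (x x' : S.E) :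
    (max (S.dE x x') 1) ^ (-S.ν) ≤ (max (S.dG x.1 x'.1 : ℝ) 1) ^ (-S.ν) :=
  Real.rpow_le_rpow_of_nonpos (by positivity) (max_le_max (le_max_left _ _) le_rfl)
    (neg_nonpos.2 hν)

lemma HalfPlane.dE_row (P : S.HalfPlane) (a i j : ℕ) (z z' : ℤ) :
    S.dE (P.ray (a + i), z) (P.ray (a + j), z') =
      max (Nat.dist i j : ℝ) (|(z : ℝ) - (z' : ℝ)| ^ (2 / S.β)) := by
  rw [dE, P.geodesic, Nat.dist_add_add_left]

lemma HalfPlane.max_dE_row_self_rpow (P : S.HalfPlane) (a i j : ℕ) (z : ℤ) :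
    (max (S.dE (P.ray (a + i), z) (P.ray (a + j), z)) 1) ^ (-S.ν) =
      (max (Nat.dist i j : ℝ) 1) ^ (-S.ν) := by
  have hβ := S.β_pos
  rw [P.dE_row, sub_self, abs_zero, Real.zero_rpow (by positivity),
    max_eq_left (Nat.cast_nonneg _)]

lemma HalfPlane.max_dE_row_rpow_le (P : S.HalfPlane) (hν : 0 ≤ S.ν) (a i j : ℕ) {z z' : ℤ}
    (hz : z ≠ z') :
    (max (S.dE (P.ray (a + i), z) (P.ray (a + j), z')) 1) ^ (-S.ν) ≤
      (max (|(z : ℝ) - (z' : ℝ)| ^ (2 / S.β)) (Nat.dist i j : ℝ)) ^ (-S.ν) := by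
  have h : 0 < |(z : ℝ) - (z' : ℝ)| := abs_pos.2 (sub_ne_zero.2 (Int.cast_injective.ne hz))
  rw [P.dE_row]
  refine Real.rpow_le_rpow_of_nonpos (lt_max_of_lt_left (by positivity)) ?_
    (neg_nonpos.2 hν)
  rw [max_comm]
  exact le_max_left _ _

namespace WalkLaw

variable (W : WalkLaw S) {cg cg' : ℝ}

lemma hitProb_column_le (hG : W.GreenBounds cg cg') (x : S.E) (y : S.V) (z : ℤ) (H : ℕ)
    {A B : ℝ} (hB : 0 < B)
    (hA : ∑ j ∈ Finset.range H, (max (S.dE x (y, z + j)) 1) ^ (-S.ν) ≤ A)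
    (hK : ∀ i < H, B ≤
      ∑ j ∈ Finset.range H, (max (Nat.dist i j : ℝ) 1) ^ (-(2 / S.β * S.ν))) :
    (W.hitProb x {x' | x'.1 = y ∧ x'.2 ∈ Set.Ico z (z + (H : ℤ))}).toReal ≤
      cg' / cg * (A / B) := by
  refine W.hitProb_le_of_greenBounds hG _ x (Finset.range H) (fun j => (y, z + j)) hB hA ?_
  rintro ⟨y', z'⟩ ⟨h1, h2, h3⟩
  obtain ⟨i, rfl⟩ := Int.le.dest h2
  simp only at h1 h3
  subst h1
  simp_rw [max_dE_column_self_rpow]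
  exact hK i (by omega)

lemma hitProb_row_le (hG : W.GreenBounds cg cg') (P : S.HalfPlane) (x : S.E) (a n : ℕ) (z : ℤ)
    {A B : ℝ} (hB : 0 < B)
    (hA : ∑ j ∈ Finset.range n, (max (S.dE x (P.ray (a + j), z)) 1) ^ (-S.ν) ≤ A)
    (hK : ∀ i < n, B ≤ ∑ j ∈ Finset.range n, (max (Nat.dist i j : ℝ) 1) ^ (-S.ν)) :
    (W.hitProb x {x' | (∃ i, a ≤ i ∧ i < a + n ∧ x'.1 = P.ray i) ∧ x'.2 = z}).toReal ≤
      cg' / cg * (A / B) := by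
  refine W.hitProb_le_of_greenBounds hG _ x (Finset.range n)
    (fun j => (P.ray (a + j), z)) hB hA ?_
  rintro ⟨y', z'⟩ ⟨⟨i, h1, h2, h3⟩, h4⟩
  obtain ⟨i, rfl⟩ := Nat.exists_eq_add_of_le h1
  simp only at h3 h4
  subst h3 h4
  simp_rw [P.max_dE_row_self_rpow]
  exact hK i (by omega)

/-- Entrance probability into a column when `α > β`. -/
lemma hitProb_column_le_of_lt (hG : W.GreenBounds cg cg') (hν : 0 ≤ S.ν)
    (hp : 1 < 2 / S.β * S.ν) {y y' : S.V} (hy : 0 < S.dG y y') (z : ℤ) {i H : ℕ} (hi : i < H)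
    {C : ℝ} (hC1 : 1 ≤ C)
    (hC : 2 * 2 ^ (2 / S.β * S.ν) * (1 + (2 / S.β * S.ν - 1)⁻¹) ≤ C) :
    (W.hitProb (y, z + i) {x' | x'.1 = y' ∧ x'.2 ∈ Set.Ico z (z + (H : ℤ))}).toReal ≤
      cg' / cg * (C * (min (H : ℝ) ((S.dG y y' : ℝ) ^ (S.β / 2)) / (S.dG y y' : ℝ) ^ S.ν)) := by
  have hβ := S.β_pos
  set r := (S.dG y y' : ℝ) with hr
  have hr1 : 1 ≤ r := Nat.one_le_cast.2 hy
  have hr0 : 0 < r := by positivity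
  set p := 2 / S.β * S.ν with hpdef
  have ht1 : 1 ≤ r ^ (S.β / 2) := Real.one_le_rpow hr1 (by positivity)
  have hβp : S.β / 2 * p = S.ν := by rw [hpdef]; field_simp
  have hsum := Finset.sum_le_sum (s := Finset.range H)
    fun j _ => max_dE_column_rpow_le hν hy z i j
  have h := W.hitProb_column_le hG (y, z + i) y' z H one_pos
    (A := C * (min (H : ℝ) (r ^ (S.β / 2)) / r ^ S.ν)) ?_
    fun i hi => one_le_sum_rpow_max_dist hi _
  · rwa [div_one] at h
  · refine hsum.trans ?_
    rw [← min_div_div_right (by positivity), mul_min_of_nonneg _ _ (by linarith)]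
    refine le_min ?_ ?_
    · have h1 : ∀ j ∈ Finset.range H,
          (max (r ^ (S.β / 2)) (Nat.dist i j : ℝ)) ^ (-p) ≤ (r ^ S.ν)⁻¹ := fun j _ => by
        rw [← hβp, Real.rpow_mul hr0.le, ← Real.rpow_neg (by positivity)]
        exact Real.rpow_le_rpow_of_nonpos (by positivity) (le_max_left _ _) (by linarith)
      refine (Finset.sum_le_card_nsmul _ _ _ h1).trans ?_
      rw [Finset.card_range, nsmul_eq_mul, ← div_eq_mul_inv]
      exact le_mul_of_one_le_left (by positivity) hC1
    · refine (sum_rpow_max_dist_le hp ht1 hi).trans ?_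
      have h2 : (r ^ (S.β / 2)) ^ (1 - p) = r ^ (S.β / 2) / r ^ S.ν := by
        rw [← Real.rpow_mul hr0.le, ← Real.rpow_sub hr0, mul_sub, mul_one, hβp]
      rw [h2]
      exact mul_le_mul_of_nonneg_right hC (by positivity)

/-- Entrance probability into a nearby column when `α = β`. -/
lemma hitProb_column_le_of_eq_near (hG : W.GreenBounds cg cg') (hν : S.ν = S.β / 2)
    {y y' : S.V} (hy : 0 < S.dG y y') (z : ℤ) {i H : ℕ} (hi : i < H) (hH : 1 < H)
    (hyH : (S.dG y y' : ℝ) < (H : ℝ) ^ (2 / S.β)) :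
    (W.hitProb (y, z + i) {x' | x'.1 = y' ∧ x'.2 ∈ Set.Ico z (z + (H : ℤ))}).toReal ≤
      cg' / cg * ((8 + 2 * S.β) *
        ((1 + Real.log ((H : ℝ) ^ (2 / S.β) / (S.dG y y' : ℝ))) / Real.log H)) := by
  have hβ := S.β_pos
  have hp : 2 / S.β * S.ν = 1 := by rw [hν]; field_simp
  set r := (S.dG y y' : ℝ) with hr
  have hr1 : 1 ≤ r := Nat.one_le_cast.2 hy
  have hr0 : 0 < r := by positivity
  have hH0 : (0 : ℝ) < H := Nat.cast_pos.2 (by omega)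
  set t := r ^ (S.β / 2) with htdef
  have ht1 : 1 ≤ t := Real.one_le_rpow hr1 (by positivity)
  have ht0 : 0 < t := by positivity
  have hHt : ((H : ℝ) ^ (2 / S.β)) ^ (S.β / 2) = H := by
    rw [← Real.rpow_mul hH0.le, show 2 / S.β * (S.β / 2) = 1 by field_simp, Real.rpow_one]
  have htH : t < H := by
    rw [← hHt]
    exact Real.rpow_lt_rpow hr0.le hyH (by positivity)
  have hlog : Real.log (H / t) = S.β / 2 * Real.log ((H : ℝ) ^ (2 / S.β) / r) := by
    rw [← Real.log_rpow (by positivity), Real.div_rpow (by positivity) hr0.le, hHt]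
  have hl0 : 0 ≤ Real.log ((H : ℝ) ^ (2 / S.β) / r) :=
    Real.log_nonneg ((one_le_div hr0).2 hyH.le)
  rw [← mul_div_assoc]
  refine W.hitProb_column_le hG _ _ _ _ (Real.log_pos (by exact_mod_cast hH)) ?_ ?_
  · refine (Finset.sum_le_sum fun j _ => max_dE_column_rpow_le
      (by rw [hν]; positivity) hy z i j).trans ?_
    rw [hp]
    refine (sum_rpow_max_dist_neg_one_le ht1 hi).trans ?_
    have h1 : Real.log ((t + H) / t) ≤ 1 + Real.log (H / t) := by
      have h2 : (t + H) / t ≤ 2 * (H / t) := by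
        rw [← mul_div_assoc]
        gcongr
        linarith
      have h3 := Real.log_le_log (by positivity) h2
      rw [Real.log_mul (by norm_num) (by positivity)] at h3
      linarith [Real.log_le_sub_one_of_pos (show (0 : ℝ) < 2 by norm_num)]
    rw [hlog] at h1
    nlinarith
  · intro i hi
    rw [hp]
    exact log_le_sum_rpow_max_dist hi

/-- Entrance probability into a distant column when `α = β`. -/
lemma hitProb_column_le_of_eq_far (hG : W.GreenBounds cg cg') (hν : S.ν = S.β / 2)
    (x : S.E) {y : S.V} (hy : 0 < S.dG x.1 y) (z : ℤ) {H : ℕ} (hH : 1 < H) :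
    (W.hitProb x {x' | x'.1 = y ∧ x'.2 ∈ Set.Ico z (z + (H : ℤ))}).toReal ≤
      cg' / cg * (H * (S.dG x.1 y : ℝ) ^ (-(S.β / 2)) / Real.log H) := by
  have hβ := S.β_pos
  have hp : 2 / S.β * S.ν = 1 := by rw [hν]; field_simp
  refine W.hitProb_column_le hG _ _ _ _ (Real.log_pos (by exact_mod_cast hH)) ?_ ?_
  · have h1 : ∀ j ∈ Finset.range H,
        (max (S.dE x (y, z + j)) 1) ^ (-S.ν) ≤ (S.dG x.1 y : ℝ) ^ (-(S.β / 2)) := fun j _ => by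
      refine (max_dE_rpow_le_dG (by rw [hν]; positivity) _ _).trans ?_
      rw [max_eq_left (Nat.one_le_cast.2 hy), hν]
    refine (Finset.sum_le_card_nsmul _ _ _ h1).trans ?_
    rw [Finset.card_range, nsmul_eq_mul]
  · intro i hi
    rw [hp]
    exact log_le_sum_rpow_max_dist hi

/-- Entrance probability into a column, a bound which is sharp when `α < β`. -/
lemma hitProb_column_le_rpow (hG : W.GreenBounds cg cg') (hν : 0 ≤ S.ν)
    (x : S.E) (y : S.V) (z : ℤ) {H : ℕ} (hH : 1 < H) :
    (W.hitProb x {x' | x'.1 = y ∧ x'.2 ∈ Set.Ico z (z + (H : ℤ))}).toReal ≤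
      cg' / cg * ((H : ℝ) ^ (2 / S.β) / max (S.dG x.1 y : ℝ) 1) ^ S.ν := by
  have hβ := S.β_pos
  have hH0 : (0 : ℝ) < H := Nat.cast_pos.2 (by omega)
  set r := max (S.dG x.1 y : ℝ) 1 with hr
  have hr0 : 0 < r := by positivity
  have hA : ∑ j ∈ Finset.range H, (max (S.dE x (y, z + j)) 1) ^ (-S.ν) ≤ H * r ^ (-S.ν) := by
    have h1 : ∀ j ∈ Finset.range H, (max (S.dE x (y, z + j)) 1) ^ (-S.ν) ≤ r ^ (-S.ν) :=
      fun j _ => max_dE_rpow_le_dG hν x (y, z + j)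
    refine (Finset.sum_le_card_nsmul _ _ _ h1).trans ?_
    rw [Finset.card_range, nsmul_eq_mul]
  have h := W.hitProb_column_le hG x y z H (B := H * (H : ℝ) ^ (-(2 / S.β * S.ν)))
    (by positivity) hA fun i hi => ?_
  · refine h.trans_eq ?_
    rw [mul_div_mul_left _ _ hH0.ne', Real.div_rpow (by positivity) hr0.le,
      ← Real.rpow_mul hH0.le, Real.rpow_neg hr0.le, Real.rpow_neg hH0.le, div_inv_eq_mul,
      mul_comm (r ^ S.ν)⁻¹, ← div_eq_mul_inv]
  · have h1 : ∀ j ∈ Finset.range H, (H : ℝ) ^ (-(2 / S.β * S.ν)) ≤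
        (max (Nat.dist i j : ℝ) 1) ^ (-(2 / S.β * S.ν)) := fun j hj => by
      refine Real.rpow_le_rpow_of_nonpos (by positivity) (max_le ?_ ?_)
        (neg_nonpos.2 (by positivity))
      · have := Finset.mem_range.1 hj
        rw [Nat.dist]
        exact_mod_cast (by omega : i - j + (j - i) ≤ H)
      · exact_mod_cast hH.le
    refine le_trans ?_ (Finset.card_nsmul_le_sum _ _ _ h1)
    rw [Finset.card_range, nsmul_eq_mul]

/-- Entrance probability into a row when `ν > 1`. -/
lemma hitProb_row_le_of_one_lt (hG : W.GreenBounds cg cg') (P : S.HalfPlane) (hν : 1 < S.ν)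
    (a : ℕ) {i n : ℕ} (hi : i < n) {z z' : ℤ} (hz : z ≠ z') :
    (W.hitProb (P.ray (a + i), z)
        {x' | (∃ i, a ≤ i ∧ i < a + n ∧ x'.1 = P.ray i) ∧ x'.2 = z'}).toReal ≤
      cg' / cg * (2 * 2 ^ S.ν * (1 + (S.ν - 1)⁻¹) *
        |(z : ℝ) - (z' : ℝ)| ^ (2 / S.β * (1 - S.ν))) := by
  have hβ := S.β_pos
  have hz1 : 1 ≤ |(z : ℝ) - (z' : ℝ)| := by
    exact_mod_cast Int.one_le_abs (sub_ne_zero.2 hz)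
  rw [Real.rpow_mul (abs_nonneg _), ← div_one (2 * _ * _ * _)]
  refine W.hitProb_row_le hG P _ a n z' one_pos ?_
    fun i hi => one_le_sum_rpow_max_dist hi _
  refine (Finset.sum_le_sum fun j _ => P.max_dE_row_rpow_le (by linarith) a i j hz).trans ?_
  exact sum_rpow_max_dist_le hν (Real.one_le_rpow hz1 (by positivity)) hi

/-- Entrance probability into a row when `ν = 1`. -/
lemma hitProb_row_le_of_eq_one (hG : W.GreenBounds cg cg') (P : S.HalfPlane) (hν : S.ν = 1)
    (a : ℕ) {i n L : ℕ} (hi : i < n) (hL : 1 < L) (hLn : L ≤ n) (hnL : n ≤ 5 * L)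
    {z z' : ℤ} (hz : z ≠ z') (hzL : |(z : ℝ) - (z' : ℝ)| ≤ (L : ℝ) ^ (S.β / 2)) :
    (W.hitProb (P.ray (a + i), z)
        {x' | (∃ i, a ≤ i ∧ i < a + n ∧ x'.1 = P.ray i) ∧ x'.2 = z'}).toReal ≤
      cg' / cg * (24 *
        ((1 + Real.log ((L : ℝ) / |(z : ℝ) - (z' : ℝ)| ^ (2 / S.β))) / Real.log L)) := by
  have hβ := S.β_pos
  have hL0 : (0 : ℝ) < L := Nat.cast_pos.2 (by omega)
  have hz1 : 1 ≤ |(z : ℝ) - (z' : ℝ)| := by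
    exact_mod_cast Int.one_le_abs (sub_ne_zero.2 hz)
  have ht1 : 1 ≤ |(z : ℝ) - (z' : ℝ)| ^ (2 / S.β) := Real.one_le_rpow hz1 (by positivity)
  have htL : |(z : ℝ) - (z' : ℝ)| ^ (2 / S.β) ≤ L := by
    refine (Real.rpow_le_rpow (abs_nonneg _) hzL (by positivity)).trans_eq ?_
    rw [← Real.rpow_mul hL0.le, show S.β / 2 * (2 / S.β) = 1 by field_simp, Real.rpow_one]
  rw [← mul_div_assoc]
  refine W.hitProb_row_le hG P _ a n z' (Real.log_pos (by exact_mod_cast hL)) ?_ ?_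
  · refine (Finset.sum_le_sum fun j _ => P.max_dE_row_rpow_le
      (by rw [hν]; exact zero_le_one) a i j hz).trans ?_
    rw [hν]
    set t := |(z : ℝ) - (z' : ℝ)| ^ (2 / S.β)
    refine (sum_rpow_max_dist_neg_one_le ht1 hi).trans ?_
    have ht0 : 0 < t := by positivity
    have h0 : 0 ≤ Real.log (L / t) := Real.log_nonneg ((one_le_div ht0).2 htL)
    have hn : (n : ℝ) ≤ 5 * L := by exact_mod_cast hnL
    have h1 : Real.log ((t + n) / t) ≤ 5 + Real.log (L / t) := by
      have h2 : (t + n) / t ≤ 6 * (L / t) := by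
        rw [← mul_div_assoc]
        gcongr
        linarith
      have h3 := Real.log_le_log (by positivity) h2
      rw [Real.log_mul (by norm_num) (by positivity)] at h3
      linarith [Real.log_le_sub_one_of_pos (show (0 : ℝ) < 6 by norm_num)]
    linarith
  · intro i hi
    rw [hν]
    refine le_trans ?_ (log_le_sum_rpow_max_dist hi)
    exact Real.log_le_log hL0 (by exact_mod_cast hLn)

end WalkLaw

end GraphSetup

/-- Lemma 5.2: bounds, for `ν ≥ 1` and `L ≥ c`, on the probability that the walk started at
`x = (y,z)` in the rectangle `D = W × J ⊆ 𝒫` ever enters the vertical segment `J_ȳ`,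
resp. the horizontal segment `W_z̄`, for `x̄ = (ȳ,z̄) ∈ D`, where `|W| ∈ [L,5L]`,
`|J| = H = ⌊(L/log L)^{β/2}⌋` and `10³ ≤ H < ⌊L^{β/2}⌋`. -/
theorem stmt16 (S : GraphSetup) (W : WalkLaw S) (cg cg' : ℝ) (hG : W.GreenBounds cg cg') :
    ∃ c : ℝ, 0 < c ∧ (1 ≤ S.ν →
      ∀ L : ℕ, c ≤ (L : ℝ) →
      ∀ (P : S.HalfPlane) (a wlen : ℕ) (z₀ : ℤ) (H : ℕ),
        H = Nat.floor (((L : ℝ) / Real.log L) ^ (S.β / 2)) →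
        10 ^ 3 ≤ H → H < Nat.floor ((L : ℝ) ^ (S.β / 2)) →
        L ≤ wlen → wlen ≤ 5 * L →
        ∀ x : S.E, (∃ i, a ≤ i ∧ i < a + wlen ∧ x.1 = P.ray i) →
          x.2 ∈ Set.Ico z₀ (z₀ + (H : ℤ)) →
        ∀ xb : S.E, (∃ i, a ≤ i ∧ i < a + wlen ∧ xb.1 = P.ray i) →
          xb.2 ∈ Set.Ico z₀ (z₀ + (H : ℤ)) →
        ((S.β < S.α → x.1 ≠ xb.1 →
          (W.hitProb x {x' | x'.1 = xb.1 ∧ x'.2 ∈ Set.Ico z₀ (z₀ + (H : ℤ))}).toReal ≤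
            c * min (H : ℝ) ((S.dG x.1 xb.1 : ℝ) ^ (S.β / 2)) / (S.dG x.1 xb.1 : ℝ) ^ S.ν) ∧
        (S.α = S.β → 0 < S.dG x.1 xb.1 → (S.dG x.1 xb.1 : ℝ) < (H : ℝ) ^ (2 / S.β) →
          (W.hitProb x {x' | x'.1 = xb.1 ∧ x'.2 ∈ Set.Ico z₀ (z₀ + (H : ℤ))}).toReal ≤
            c * (1 + Real.log ((H : ℝ) ^ (2 / S.β) / (S.dG x.1 xb.1 : ℝ))) / Real.log H) ∧
        (S.α = S.β → (H : ℝ) ^ (2 / S.β) ≤ (S.dG x.1 xb.1 : ℝ) →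
          (W.hitProb x {x' | x'.1 = xb.1 ∧ x'.2 ∈ Set.Ico z₀ (z₀ + (H : ℤ))}).toReal ≤
            c * (H : ℝ) * (S.dG x.1 xb.1 : ℝ) ^ (-(S.β / 2)) / Real.log H) ∧
        (S.α < S.β →
          (W.hitProb x {x' | x'.1 = xb.1 ∧ x'.2 ∈ Set.Ico z₀ (z₀ + (H : ℤ))}).toReal ≤
            c * min 1 (((H : ℝ) ^ (2 / S.β) / max (S.dG x.1 xb.1 : ℝ) 1) ^ S.ν))) ∧
        ((1 < S.ν →
          (W.hitProb x
              {x' | (∃ i, a ≤ i ∧ i < a + wlen ∧ x'.1 = P.ray i) ∧ x'.2 = xb.2}).toReal ≤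
            c * min 1 ((max |(x.2 : ℝ) - (xb.2 : ℝ)| 1) ^ (2 / S.β * (1 - S.ν)))) ∧
        (S.ν = 1 → x.2 ≠ xb.2 →
          (W.hitProb x
              {x' | (∃ i, a ≤ i ∧ i < a + wlen ∧ x'.1 = P.ray i) ∧ x'.2 = xb.2}).toReal ≤
            c * (1 + Real.log ((L : ℝ) / |(x.2 : ℝ) - (xb.2 : ℝ)| ^ (2 / S.β))) /
              Real.log L))) := by
  obtain ⟨h0, h01, -⟩ := id hG
  have hβ := S.β_pos
  have hC0 : 1 ≤ cg' / cg := (one_le_div h0).2 h01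
  set C₁ := 2 * 2 ^ (2 / S.β * S.ν) * (1 + (2 / S.β * S.ν - 1)⁻¹) with hC₁
  set C₂ := 2 * 2 ^ S.ν * (1 + (S.ν - 1)⁻¹) with hC₂
  set M := 24 + 2 * S.β + |C₁| + |C₂| with hM
  have hM24 : 24 + 2 * S.β ≤ M := by linarith [abs_nonneg C₁, abs_nonneg C₂]
  have hMC₁ : C₁ ≤ M := by linarith [le_abs_self C₁, abs_nonneg C₂]
  have hMC₂ : C₂ ≤ M := by linarith [le_abs_self C₂, abs_nonneg C₁]
  have hcM : M ≤ cg' / cg * M := le_mul_of_one_le_left (by linarith) hC0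
  have combine : ∀ {h X m : ℝ}, h ≤ cg' / cg * (m * X) → m ≤ M → 0 ≤ X →
      h ≤ cg' / cg * M * X := fun hh hm hX => by
    rw [mul_assoc]
    exact hh.trans (mul_le_mul_of_nonneg_left (mul_le_mul_of_nonneg_right hm hX) (by linarith))
  refine ⟨cg' / cg * M, by linarith, ?_⟩
  rintro hν L hcL P a wlen z₀ H - hH hHL hLw hwL ⟨y, z⟩ ⟨i, hai, hiw, rfl⟩ ⟨hz1, hz2⟩
    ⟨y', z'⟩ - ⟨hz1', hz2'⟩
  obtain ⟨k, rfl⟩ := Int.le.dest hz1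
  obtain ⟨i, rfl⟩ := Nat.exists_eq_add_of_le hai
  simp only at hz2 hz1' hz2' ⊢
  have hk : k < H := by omega
  have hi : i < wlen := by omega
  have hL1 : 1 < L := by
    have : (1 : ℝ) < L := by linarith
    exact_mod_cast this
  have hH1 : 1 < H := by omega
  have hH0 : (0 : ℝ) < H := Nat.cast_pos.2 (by omega)
  have hlogH : 0 < Real.log H := Real.log_pos (by exact_mod_cast hH1)
  have hlogL : 0 < Real.log L := Real.log_pos (by exact_mod_cast hL1)
  have hν0 : 0 ≤ S.ν := by linarith
  refine ⟨⟨fun hαβ hy => ?_, fun hαβ hy hyH => ?_, fun hαβ hyH => ?_, fun _ => ?_⟩,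
    fun hν1 => ?_, fun hν1 hz => ?_⟩
  · have hp : 1 < 2 / S.β * S.ν := by
      rw [div_mul_eq_mul_div, lt_div_iff₀ hβ, ν]
      linarith
    rw [mul_div_assoc]
    exact combine (W.hitProb_column_le_of_lt hG hν0 hp (dG_pos hy) z₀ hk (by linarith) hMC₁)
      le_rfl (by positivity)
  · have hν' : S.ν = S.β / 2 := by rw [ν, hαβ]; ring
    rw [mul_div_assoc]
    refine combine (W.hitProb_column_le_of_eq_near hG hν' hy z₀ hk hH1 hyH)
      (by linarith) ?_
    have : 0 ≤ Real.log ((H : ℝ) ^ (2 / S.β) / (S.dG (P.ray (a + i)) y' : ℝ)) :=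
      Real.log_nonneg ((one_le_div (Nat.cast_pos.2 hy)).2 hyH.le)
    positivity
  · have hν' : S.ν = S.β / 2 := by rw [ν, hαβ]; ring
    have hy : 0 < S.dG (P.ray (a + i)) y' := by
      have : (0 : ℝ) < S.dG (P.ray (a + i)) y' := lt_of_lt_of_le (by positivity) hyH
      exact_mod_cast this
    have h := W.hitProb_column_le_of_eq_far hG hν' (P.ray (a + i), z₀ + k) hy z₀ hH1
    rw [mul_assoc _ (H : ℝ), mul_div_assoc]
    exact combine (m := 1) (by rwa [one_mul]) (by linarith) (by positivity)
  · have h := W.hitProb_column_le_rpow hG hν0 (P.ray (a + i), z₀ + k) y' z₀ hH1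
    rw [mul_min_of_nonneg _ _ (by linarith)]
    refine le_min ((W.hitProb_toReal_le_one _ _).trans (by linarith)) ?_
    exact combine (m := 1) (by rwa [one_mul]) (by linarith) (by positivity)
  · rw [mul_min_of_nonneg _ _ (by linarith)]
    refine le_min ((W.hitProb_toReal_le_one _ _).trans (by linarith)) ?_
    by_cases hz : z₀ + k = z'
    · refine (W.hitProb_toReal_le_one _ _).trans ?_
      simp only [hz, sub_self, abs_zero, zero_le_one, sup_of_le_right, Real.one_rpow]
      linarith
    · have hz1 : 1 ≤ |((z₀ + k : ℤ) : ℝ) - (z' : ℝ)| := by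
        exact_mod_cast Int.one_le_abs (sub_ne_zero.2 hz)
      rw [max_eq_left hz1]
      exact combine (W.hitProb_row_le_of_one_lt hG P hν1 a hi hz) hMC₂ (by positivity)
  · have hzL : |((z₀ + k : ℤ) : ℝ) - (z' : ℝ)| ≤ (L : ℝ) ^ (S.β / 2) := by
      have h1 : |((z₀ + k : ℤ) : ℝ) - (z' : ℝ)| ≤ H := by
        have : |(z₀ + k : ℤ) - z'| ≤ (H : ℤ) := by rw [abs_le]; omega
        exact_mod_cast this
      refine h1.trans (le_trans ?_ (Nat.floor_le (by positivity : 0 ≤ (L : ℝ) ^ (S.β / 2))))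
      exact_mod_cast hHL.le
    rw [mul_div_assoc]
    refine combine (W.hitProb_row_le_of_eq_one hG P hν1 a hi hL1 hLw hwL hz hzL)
      (by linarith) (div_nonneg (add_nonneg zero_le_one (Real.log_nonneg ?_)) hlogL.le)
    have hz1 : 1 ≤ |((z₀ + k : ℤ) : ℝ) - (z' : ℝ)| := by
      exact_mod_cast Int.one_le_abs (sub_ne_zero.2 hz)
    rw [one_le_div (by positivity)]
    refine (Real.rpow_le_rpow (abs_nonneg _) hzL (by positivity)).trans_eq ?_
    rw [← Real.rpow_mul (Nat.cast_nonneg _), show S.β / 2 * (2 / S.β) = 1 by field_simp,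
      Real.rpow_one]
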